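/- arXiv:0908.1181 — 12 statements merged into one kernel-verified Lean document; each statement's English description precedes it below -/
import Mathlib

section
/- Let n ≥ 1, let N ⊆ ℝⁿ be a compact convex set contained in the nonnegative orthant, let c ∈ N, and suppose the game (N, c) is feasible, i.e., there exists v ∈ N with v_i > c_i for every i. Then there is exactly one point v* in the set {v ∈ N : v_i ≥ c_i for all i} that maximizes the product ∏_{i=1}^n (v_i − c_i) over this set, and this maximizer satisfies v*_i > c_i for every i. -/
/-- Nash's theorem (characterization part): a feasible Nash bargaining game
`(N, c)` has a unique maximizer of `∏ i, (v i - c i)` over the points of `N`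
dominating `c`, and this maximizer strictly dominates `c`. -/
theorem stmt_0 (n : ℕ) (hn : 1 ≤ n) (N : Set (Fin n → ℝ))
    (hcpt : IsCompact N) (hconv : Convex ℝ N)
    (hpos : ∀ v ∈ N, ∀ i, 0 ≤ v i)
    (c : Fin n → ℝ) (hc : c ∈ N)
    (hfeas : ∃ v ∈ N, ∀ i, c i < v i) :
    (∃! v : Fin n → ℝ, v ∈ N ∧ (∀ i, c i ≤ v i) ∧
        ∀ u ∈ N, (∀ i, c i ≤ u i) →
          ∏ i, (u i - c i) ≤ ∏ i, (v i - c i)) ∧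
    (∀ v : Fin n → ℝ, (v ∈ N ∧ (∀ i, c i ≤ v i) ∧
        ∀ u ∈ N, (∀ i, c i ≤ u i) →
          ∏ i, (u i - c i) ≤ ∏ i, (v i - c i)) →
      ∀ i, c i < v i) := by
  have hstrict : ∀ v : Fin n → ℝ, (v ∈ N ∧ (∀ i, c i ≤ v i) ∧
        ∀ u ∈ N, (∀ i, c i ≤ u i) →
          ∏ i, (u i - c i) ≤ ∏ i, (v i - c i)) →
      ∀ i, c i < v i := by
    rintro v ⟨hv, hcv, hmax⟩ i
    obtain ⟨w, hw, hcw⟩ := hfeas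
    have h1 := hmax w hw (fun i => (hcw i).le)
    have h2 : 0 < ∏ i, (w i - c i) := Finset.prod_pos (fun i _ => sub_pos.2 (hcw i))
    refine lt_of_le_of_ne (hcv i) (fun h => ?_)
    have h3 : ∏ i, (v i - c i) = 0 :=
      Finset.prod_eq_zero (Finset.mem_univ i) (by rw [h, sub_self])
    linarith
  refine ⟨?_, hstrict⟩
  have hK : IsCompact (N ∩ Set.Ici c) := hcpt.inter_right isClosed_Ici
  have hcont : Continuous (fun v : Fin n → ℝ => ∏ i, (v i - c i)) := by fun_prop
  obtain ⟨v, ⟨hvN, hvc⟩, hvm⟩ := hK.exists_isMaxOn ⟨c, hc, le_refl c⟩ hcont.continuousOn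
  have hv : v ∈ N ∧ (∀ i, c i ≤ v i) ∧ ∀ u ∈ N, (∀ i, c i ≤ u i) →
          ∏ i, (u i - c i) ≤ ∏ i, (v i - c i) :=
    ⟨hvN, hvc, fun u hu huc => hvm (a := u) ⟨hu, huc⟩⟩
  refine ⟨v, hv, ?_⟩
  intro y hy
  have hvs := hstrict v hv
  have hys := hstrict y hy
  by_contra hne
  obtain ⟨j, hj⟩ := Function.ne_iff.1 hne
  have hm : (1/2 : ℝ) • v + (1/2 : ℝ) • y ∈ N :=
    hconv hvN hy.1 (by norm_num) (by norm_num) (by norm_num)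
  have hmi : ∀ i, ((1/2 : ℝ) • v + (1/2 : ℝ) • y) i = (v i + y i) / 2 := by
    intro i
    simp only [Pi.add_apply, Pi.smul_apply, smul_eq_mul]
    ring
  generalize (1/2 : ℝ) • v + (1/2 : ℝ) • y = m at hm hmi
  have hmc : ∀ i, c i < m i := fun i => by
    have := hvs i
    have := hys i
    rw [hmi]
    linarith
  have e1 := hv.2.2 m hm (fun i => (hmc i).le)
  have e2 := hy.2.2 m hm (fun i => (hmc i).le)
  have hmp : 0 < ∏ i, (m i - c i) := Finset.prod_pos (fun i _ => sub_pos.2 (hmc i))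
  have key : ∏ i, ((v i - c i) * (y i - c i)) < ∏ i, ((m i - c i) * (m i - c i)) := by
    refine Finset.prod_lt_prod
      (fun i _ => mul_pos (sub_pos.2 (hvs i)) (sub_pos.2 (hys i)))
      (fun i _ => ?_) ⟨j, Finset.mem_univ j, ?_⟩
    · rw [hmi]
      nlinarith [sq_nonneg (v i - y i)]
    · rw [hmi]
      have : 0 < (y j - v j) ^ 2 := by
        have := sub_ne_zero.2 hj
        positivity
      nlinarith
  rw [Finset.prod_mul_distrib, Finset.prod_mul_distrib] at key
  have := mul_le_mul e1 e2 hmp.le (hmp.le.trans e1)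
  linarith
end

section
/- Let n ≥ 1, let N ⊆ ℝⁿ be a compact convex set contained in the nonnegative orthant, let c ∈ N, let w_1, …, w_n be positive reals, and suppose there exists v ∈ N with v_i > c_i for every i. Then there is exactly one point v* in the set {v ∈ N : v_i ≥ c_i for all i} that maximizes the weighted product ∏_{i=1}^n (v_i − c_i)^{w_i} over this set, and this maximizer satisfies v*_i > c_i for every i. -/
/-- Kalai's theorem (characterization part): a feasible nonsymmetric bargaining
game `(N, c)` with positive clouts `w` has a unique maximizer of
`∏ i, (v i - c i) ^ (w i)` over the points of `N` dominating `c`, and this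
maximizer strictly dominates `c`. -/
theorem stmt_1 (n : ℕ) (hn : 1 ≤ n) (N : Set (Fin n → ℝ))
    (hcpt : IsCompact N) (hconv : Convex ℝ N)
    (hpos : ∀ v ∈ N, ∀ i, 0 ≤ v i)
    (c : Fin n → ℝ) (hc : c ∈ N)
    (w : Fin n → ℝ) (hw : ∀ i, 0 < w i)
    (hfeas : ∃ v ∈ N, ∀ i, c i < v i) :
    (∃! v : Fin n → ℝ, v ∈ N ∧ (∀ i, c i ≤ v i) ∧
        ∀ u ∈ N, (∀ i, c i ≤ u i) →
          ∏ i, (u i - c i) ^ (w i) ≤ ∏ i, (v i - c i) ^ (w i)) ∧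
    (∀ v : Fin n → ℝ, (v ∈ N ∧ (∀ i, c i ≤ v i) ∧
        ∀ u ∈ N, (∀ i, c i ≤ u i) →
          ∏ i, (u i - c i) ^ (w i) ≤ ∏ i, (v i - c i) ^ (w i)) →
      ∀ i, c i < v i) := by
  have hstrict : ∀ v : Fin n → ℝ, (v ∈ N ∧ (∀ i, c i ≤ v i) ∧
        ∀ u ∈ N, (∀ i, c i ≤ u i) →
          ∏ i, (u i - c i) ^ (w i) ≤ ∏ i, (v i - c i) ^ (w i)) →
      ∀ i, c i < v i := by
    rintro v ⟨hv, hcv, hmax⟩ i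
    obtain ⟨u, hu, hcu⟩ := hfeas
    by_contra hi
    have hvi : v i - c i = 0 := by linarith [hcv i]
    have h0 : ∏ i, (v i - c i) ^ (w i) = 0 := by
      apply Finset.prod_eq_zero (Finset.mem_univ i)
      rw [hvi, Real.zero_rpow (hw i).ne']
    have h1 : 0 < ∏ i, (u i - c i) ^ (w i) :=
      Finset.prod_pos fun j _ => Real.rpow_pos_of_pos (sub_pos.2 (hcu j)) _
    linarith [hmax u hu fun j => (hcu j).le]
  refine ⟨?_, hstrict⟩
  have hcl : IsClosed {v : Fin n → ℝ | ∀ i, c i ≤ v i} := isClosed_Ici (a := c)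
  have hcont : Continuous fun v : Fin n → ℝ => ∏ i, (v i - c i) ^ (w i) := by
    apply continuous_finsetProd
    intro i _
    exact ((continuous_apply i).sub continuous_const).rpow_const fun _ => Or.inr (hw i).le
  obtain ⟨v, ⟨hv, hcv⟩, hmax⟩ := (hcpt.inter_right hcl).exists_isMaxOn
    ⟨c, hc, fun i => le_rfl⟩ hcont.continuousOn
  have hV : v ∈ N ∧ (∀ i, c i ≤ v i) ∧
        ∀ u ∈ N, (∀ i, c i ≤ u i) →
          ∏ i, (u i - c i) ^ (w i) ≤ ∏ i, (v i - c i) ^ (w i) :=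
    ⟨hv, hcv, fun u hu hcu => hmax ⟨hu, hcu⟩⟩
  refine ⟨v, hV, ?_⟩
  intro u hU
  by_contra hne
  obtain ⟨k, hk⟩ := Function.ne_iff.1 hne
  have su := hstrict u hU
  have sv := hstrict v hV
  have hm : (1/2 : ℝ) • u + (1/2 : ℝ) • v ∈ N :=
    hconv hU.1 hv (by norm_num) (by norm_num) (by norm_num)
  set m := (1/2 : ℝ) • u + (1/2 : ℝ) • v with hmdef
  have hmi : ∀ i, m i = (u i + v i) / 2 := by
    intro i
    simp [hmdef]
    ring
  have sm : ∀ i, c i < m i := fun i => by rw [hmi]; linarith [su i, sv i]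
  have e1 := hV.2.2 m hm fun i => (sm i).le
  have e2 := hU.2.2 v hv hcv
  have e3 := hU.2.2 m hm fun i => (sm i).le
  have hlt : ∏ i, ((u i - c i) * (v i - c i)) ^ (w i) <
      ∏ i, ((m i - c i) * (m i - c i)) ^ (w i) := by
    apply Finset.prod_lt_prod
    · intro i _
      exact Real.rpow_pos_of_pos (mul_pos (sub_pos.2 (su i)) (sub_pos.2 (sv i))) _
    · intro i _
      apply Real.rpow_le_rpow (mul_pos (sub_pos.2 (su i)) (sub_pos.2 (sv i))).le _ (hw i).le
      rw [hmi]
      nlinarith [sq_nonneg (u i - v i)]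
    · refine ⟨k, Finset.mem_univ k, ?_⟩
      apply Real.rpow_lt_rpow (mul_pos (sub_pos.2 (su k)) (sub_pos.2 (sv k))).le _ (hw k)
      rw [hmi]
      nlinarith [sq_pos_of_ne_zero (sub_ne_zero.2 hk)]
  have key : ∀ a b : Fin n → ℝ, (∀ i, c i < a i) → (∀ i, c i < b i) →
      ∏ i, ((a i - c i) * (b i - c i)) ^ (w i) =
      (∏ i, (a i - c i) ^ (w i)) * ∏ i, (b i - c i) ^ (w i) := by
    intro a b ha hb
    rw [← Finset.prod_mul_distrib]
    exact Finset.prod_congr rfl fun i _ =>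
      Real.mul_rpow (sub_pos.2 (ha i)).le (sub_pos.2 (hb i)).le
  rw [key u v su sv, key m m sm sm] at hlt
  have pm : 0 < ∏ i, (m i - c i) ^ (w i) :=
    Finset.prod_pos fun j _ => Real.rpow_pos_of_pos (sub_pos.2 (sm j)) _
  have := mul_le_mul e3 e1 pm.le (pm.le.trans e3)
  linarith
end

section
/- Let w₁, w₂, α, β be positive reals and let N ⊆ {(y₁, y₂) ∈ ℝ² : y₁ ≥ 0, y₂ ≥ 0, y₁ + α·y₂ ≤ β} be a convex set. Suppose (a, b) with a > 0 and b > 0 maximizes g(y₁, y₂) = w₁·log y₁ + w₂·log y₂ over {(y₁, y₂) ∈ N : y₁ > 0, y₂ > 0}, and suppose there exist two points P, Q ∈ N lying on the line y₁ + α·y₂ = β such that (a, b) lies strictly between P and Q on this line. Then (a/w₁)/(b/w₂) = α. -/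
/-- Lemma (facet case): if the bargaining solution `(a, b)` lies strictly in the
interior of a facet `y₁ + α·y₂ ≤ β` of the feasible region `N`, then the
parameter `z = (a/w₁)/(b/w₂)` equals `α`. -/
theorem stmt_4 (w₁ w₂ α β : ℝ) (hw₁ : 0 < w₁) (hw₂ : 0 < w₂)
    (hα : 0 < α) (hβ : 0 < β)
    (N : Set (ℝ × ℝ)) (hconv : Convex ℝ N)
    (hN : N ⊆ {y : ℝ × ℝ | 0 ≤ y.1 ∧ 0 ≤ y.2 ∧ y.1 + α * y.2 ≤ β})
    (a b : ℝ) (ha : 0 < a) (hb : 0 < b) (hab : (a, b) ∈ N)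
    (hmax : ∀ y ∈ N, 0 < y.1 → 0 < y.2 →
      w₁ * Real.log y.1 + w₂ * Real.log y.2 ≤
        w₁ * Real.log a + w₂ * Real.log b)
    (P Q : ℝ × ℝ) (hP : P ∈ N) (hQ : Q ∈ N) (hPQ : P ≠ Q)
    (hPline : P.1 + α * P.2 = β) (hQline : Q.1 + α * Q.2 = β)
    (hbetween : ∃ t : ℝ, 0 < t ∧ t < 1 ∧
      a = (1 - t) * P.1 + t * Q.1 ∧ b = (1 - t) * P.2 + t * Q.2) :
    (a / w₁) / (b / w₂) = α := by
  obtain ⟨t, ht0, ht1, hat, hbt⟩ := hbetween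
  have h1 : HasDerivAt (fun s : ℝ => (1 - s) * P.1 + s * Q.1) (Q.1 - P.1) t := by
    have h := (((hasDerivAt_id t).const_sub 1).mul_const P.1).add
      ((hasDerivAt_id t).mul_const Q.1)
    exact h.congr_deriv (by ring)
  have h2 : HasDerivAt (fun s : ℝ => (1 - s) * P.2 + s * Q.2) (Q.2 - P.2) t := by
    have h := (((hasDerivAt_id t).const_sub 1).mul_const P.2).add
      ((hasDerivAt_id t).mul_const Q.2)
    exact h.congr_deriv (by ring)
  have p1 : 0 < (1 - t) * P.1 + t * Q.1 := hat ▸ ha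
  have p2 : 0 < (1 - t) * P.2 + t * Q.2 := hbt ▸ hb
  have hd := ((h1.log p1.ne').const_mul w₁).add ((h2.log p2.ne').const_mul w₂)
  have hloc : IsLocalMax ((fun s : ℝ => w₁ * Real.log ((1 - s) * P.1 + s * Q.1)) +
      (fun s : ℝ => w₂ * Real.log ((1 - s) * P.2 + s * Q.2))) t := by
    filter_upwards [Ioo_mem_nhds ht0 ht1, h1.continuousAt.eventually (lt_mem_nhds p1),
      h2.continuousAt.eventually (lt_mem_nhds p2)] with s hs q1 q2
    have hm := hconv hP hQ (sub_nonneg.2 hs.2.le) hs.1.le (by ring)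
    have := hmax _ hm (by simpa using q1) (by simpa using q2)
    simpa [hat, hbt] using this
  have h0 := hloc.hasDerivAt_eq_zero hd
  rw [← hat, ← hbt] at h0
  have e : Q.1 - P.1 = -α * (Q.2 - P.2) := by linarith
  have hne : Q.2 - P.2 ≠ 0 := by
    intro h
    apply hPQ
    rw [h] at e
    exact Prod.ext (by linarith) (by linarith)
  rw [e] at h0
  field_simp at h0 ⊢
  have h3 : (Q.2 - P.2) * (a * w₂ - w₁ * α * b) = 0 := by linarith
  rcases mul_eq_zero.1 h3 with h | h
  · exact absurd h hne
  · linarith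
end

section
/- Let w₁, w₂ be positive reals, let 0 < α₁ < α₂, and let N ⊆ ℝ² be a convex set. Let (a, b) ∈ N with a > 0 and b > 0, set β₁ = a + α₁·b and β₂ = a + α₂·b, and suppose N ⊆ {(y₁,y₂) : y₁ + α₁·y₂ ≤ β₁} ∩ {(y₁,y₂) : y₁ + α₂·y₂ ≤ β₂}, and that each of the two lines y₁ + α₁·y₂ = β₁ and y₁ + α₂·y₂ = β₂ contains at least one point of N other than (a, b). If (a, b) maximizes g(y₁, y₂) = w₁·log y₁ + w₂·log y₂ over {(y₁, y₂) ∈ N : y₁ > 0, y₂ > 0}, then α₁ ≤ (a/w₁)/(b/w₂) ≤ α₂. -/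
theorem dir_aux (w₁ w₂ : ℝ) (hw₁ : 0 < w₁) (hw₂ : 0 < w₂)
    (N : Set (ℝ × ℝ)) (hconv : Convex ℝ N)
    (a b : ℝ) (ha : 0 < a) (hb : 0 < b) (hab : (a, b) ∈ N)
    (hmax : ∀ y ∈ N, 0 < y.1 → 0 < y.2 →
      w₁ * Real.log y.1 + w₂ * Real.log y.2 ≤
        w₁ * Real.log a + w₂ * Real.log b) (u v : ℝ) (h : (a + u, b + v) ∈ N) :
    w₁ * (u / a) + w₂ * (v / b) ≤ 0 := by
  have c1 : ContinuousAt (fun e : ℝ => a + e * u) 0 := by fun_prop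
  have c2 : ContinuousAt (fun e : ℝ => b + e * v) 0 := by fun_prop
  have ct : ContinuousAt (fun e : ℝ => w₁ * (u / (a + e * u)) + w₂ * (v / (b + e * v))) 0 := by
    refine (continuousAt_const.mul (continuousAt_const.div c1 ?_)).add
      (continuousAt_const.mul (continuousAt_const.div c2 ?_)) <;> simp [ha.ne', hb.ne']
  have ht : Filter.Tendsto (fun e : ℝ => w₁ * (u / (a + e * u)) + w₂ * (v / (b + e * v)))
      (nhdsWithin 0 (Set.Ioi 0)) (nhds (w₁ * (u / a) + w₂ * (v / b))) := by
    have := ct.tendsto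
    simp only [zero_mul, add_zero] at this
    exact this.mono_left nhdsWithin_le_nhds
  refine le_of_tendsto ht ?_
  have p1 : ∀ᶠ e in nhdsWithin (0:ℝ) (Set.Ioi 0), 0 < a + e * u :=
    nhdsWithin_le_nhds (c1.eventually (lt_mem_nhds (by simpa using ha)))
  have p2 : ∀ᶠ e in nhdsWithin (0:ℝ) (Set.Ioi 0), 0 < b + e * v :=
    nhdsWithin_le_nhds (c2.eventually (lt_mem_nhds (by simpa using hb)))
  have p3 : ∀ᶠ e in nhdsWithin (0:ℝ) (Set.Ioi 0), e < 1 :=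
    nhdsWithin_le_nhds (gt_mem_nhds one_pos)
  filter_upwards [p1, p2, p3, self_mem_nhdsWithin] with e h1 h2 h3 h0
  have h0 : 0 < e := h0
  have hm : (a + e * u, b + e * v) ∈ N := by
    have := hconv hab h (by linarith : 0 ≤ 1 - e) h0.le (by ring)
    convert this using 1
    ext <;> simp <;> ring
  have hx := hmax _ hm h1 h2
  simp only at hx
  have key : ∀ c d : ℝ, 0 < c → 0 < c + e * d →
      e * (d / (c + e * d)) ≤ Real.log (c + e * d) - Real.log c := by
    intro c d hc hd
    have := Real.log_le_sub_one_of_pos (div_pos hc hd)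
    rw [Real.log_div hc.ne' hd.ne'] at this
    have e1 : e * (d / (c + e * d)) = 1 - c / (c + e * d) := by
      field_simp
      ring
    linarith
  have k1 := mul_le_mul_of_nonneg_left (key a u ha h1) hw₁.le
  have k2 := mul_le_mul_of_nonneg_left (key b v hb h2) hw₂.le
  by_contra! hc
  have := mul_pos h0 hc
  nlinarith

/-- Lemma (vertex case): if the bargaining solution `(a, b)` lies at a vertex at
the intersection of two facets with slope parameters `α₁ < α₂`, then the
parameter `z = (a/w₁)/(b/w₂)` lies between `α₁` and `α₂`. -/
theorem stmt_5 (w₁ w₂ α₁ α₂ : ℝ) (hw₁ : 0 < w₁) (hw₂ : 0 < w₂)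
    (hα₁ : 0 < α₁) (hα₁₂ : α₁ < α₂)
    (N : Set (ℝ × ℝ)) (hconv : Convex ℝ N)
    (a b : ℝ) (ha : 0 < a) (hb : 0 < b) (hab : (a, b) ∈ N)
    (hN : N ⊆ {y : ℝ × ℝ | y.1 + α₁ * y.2 ≤ a + α₁ * b} ∩
            {y : ℝ × ℝ | y.1 + α₂ * y.2 ≤ a + α₂ * b})
    (hline₁ : ∃ P ∈ N, P ≠ (a, b) ∧ P.1 + α₁ * P.2 = a + α₁ * b)
    (hline₂ : ∃ Q ∈ N, Q ≠ (a, b) ∧ Q.1 + α₂ * Q.2 = a + α₂ * b)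
    (hmax : ∀ y ∈ N, 0 < y.1 → 0 < y.2 →
      w₁ * Real.log y.1 + w₂ * Real.log y.2 ≤
        w₁ * Real.log a + w₂ * Real.log b) :
    α₁ ≤ (a / w₁) / (b / w₂) ∧ (a / w₁) / (b / w₂) ≤ α₂ := by
  have D := dir_aux w₁ w₂ hw₁ hw₂ N hconv a b ha hb hab hmax
  obtain ⟨⟨p, q⟩, hP, hPn, hPl⟩ := hline₁
  obtain ⟨⟨r, s⟩, hQ, hQn, hQl⟩ := hline₂
  have hP2 := (hN hP).2
  have hQ1 := (hN hQ).1
  simp only [Set.mem_setOf_eq] at hP2 hQ1 hPl hQl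
  have z : a / w₁ / (b / w₂) = a * w₂ / (b * w₁) := by field_simp
  have hbw : 0 < b * w₁ := by positivity
  have conv : ∀ u v : ℝ, (a + u, b + v) ∈ N → w₁ * u * b + w₂ * v * a ≤ 0 := by
    intro u v h
    have h1 := D u v h
    have h2 : w₁ * u * b + w₂ * v * a = (w₁ * (u / a) + w₂ * (v / b)) * (a * b) := by
      field_simp
    rw [h2]
    exact mul_nonpos_of_nonpos_of_nonneg h1 (by positivity)
  have hq : q < b := by
    rcases lt_trichotomy q b with h | h | h
    · exact h
    · subst h
      exact absurd (by ext <;> simp; linarith) hPn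
    · nlinarith
  have hs : b < s := by
    rcases lt_trichotomy s b with h | h | h
    · nlinarith
    · subst h
      exact absurd (by ext <;> simp; linarith) hQn
    · exact h
  have d1 := conv (p - a) (q - b) (by simpa using hP)
  have d2 := conv (r - a) (s - b) (by simpa using hQ)
  have e1 : p - a = α₁ * (b - q) := by linarith
  have e2 : r - a = -(α₂ * (s - b)) := by linarith
  rw [e1] at d1
  rw [e2] at d2
  rw [z, le_div_iff₀ hbw, div_le_iff₀ hbw]
  constructor
  · refine le_of_mul_le_mul_right ?_ (sub_pos.2 hq)
    linarith
  · refine le_of_mul_le_mul_right ?_ (sub_pos.2 hs)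
    linarith
end

section
/- Let w₁, w₂, α, β be positive reals, let (a₁, b₁) and (a₂, b₂) be points with 0 ≤ a₁ < a₂, b₁ ≥ 0, b₂ ≥ 0, a₁ + α·b₁ = β and a₂ + α·b₂ = β, and let S be the segment joining them. Let N be a convex set with S ⊆ N ⊆ {(y₁,y₂) : y₁ ≥ 0, y₂ ≥ 0, y₁ + α·y₂ ≤ β}. If w₁/(w₁+w₂) ∈ [a₁/β, a₂/β], then the point (β·w₁/(w₁+w₂), β·w₂/(α·(w₁+w₂))) lies on S and is the unique maximizer of g(y₁, y₂) = w₁·log y₁ + w₂·log y₂ over {(y₁, y₂) ∈ N : y₁ > 0, y₂ > 0}. -/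
theorem aux_le (w c p u : ℝ) (hw : 0 < w) (hp : 0 < p) (hu : 0 < u) (hc : w = c * p) :
    w * Real.log u ≤ w * Real.log p + c * (u - p) := by
  have h := Real.log_le_sub_one_of_pos (div_pos hu hp)
  rw [Real.log_div hu.ne' hp.ne'] at h
  have h2 := mul_le_mul_of_nonneg_left h hw.le
  have h3 : w * (u / p - 1) = c * (u - p) := by rw [hc]; field_simp
  linarith

theorem aux_lt (w c p u : ℝ) (hw : 0 < w) (hp : 0 < p) (hu : 0 < u) (hc : w = c * p)
    (hne : u ≠ p) :
    w * Real.log u < w * Real.log p + c * (u - p) := by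
  have h := Real.log_lt_sub_one_of_pos (div_pos hu hp)
    (fun h => hne ((div_eq_one_iff_eq hp.ne').1 h))
  rw [Real.log_div hu.ne' hp.ne'] at h
  have h2 := mul_lt_mul_of_pos_left h hw
  have h3 : w * (u / p - 1) = c * (u - p) := by rw [hc]; field_simp
  linarith

/-- Lemma (test for a facet): if `w₁/(w₁+w₂) ∈ [a₁/β, a₂/β]` then the solution
lies on the facet with endpoints `(a₁,b₁)` and `(a₂,b₂)` on the line
`y₁ + α·y₂ = β`, namely at `(β·w₁/(w₁+w₂), β·w₂/(α·(w₁+w₂)))`, which is the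
unique maximizer of `g` over `N` intersected with the open positive quadrant. -/
theorem stmt_6 (w₁ w₂ α β : ℝ) (hw₁ : 0 < w₁) (hw₂ : 0 < w₂)
    (hα : 0 < α) (hβ : 0 < β)
    (a₁ b₁ a₂ b₂ : ℝ) (ha₁ : 0 ≤ a₁) (ha₁₂ : a₁ < a₂)
    (hb₁ : 0 ≤ b₁) (hb₂ : 0 ≤ b₂)
    (hl₁ : a₁ + α * b₁ = β) (hl₂ : a₂ + α * b₂ = β)
    (N : Set (ℝ × ℝ)) (hconv : Convex ℝ N)
    (hSN : segment ℝ (a₁, b₁) (a₂, b₂) ⊆ N)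
    (hN : N ⊆ {y : ℝ × ℝ | 0 ≤ y.1 ∧ 0 ≤ y.2 ∧ y.1 + α * y.2 ≤ β})
    (hr : a₁ / β ≤ w₁ / (w₁ + w₂) ∧ w₁ / (w₁ + w₂) ≤ a₂ / β) :
    (β * w₁ / (w₁ + w₂), β * w₂ / (α * (w₁ + w₂))) ∈
        segment ℝ (a₁, b₁) (a₂, b₂) ∧
    (∀ y ∈ N, 0 < y.1 → 0 < y.2 →
      w₁ * Real.log y.1 + w₂ * Real.log y.2 ≤
        w₁ * Real.log (β * w₁ / (w₁ + w₂)) +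
          w₂ * Real.log (β * w₂ / (α * (w₁ + w₂)))) ∧
    (∀ y ∈ N, 0 < y.1 → 0 < y.2 →
      w₁ * Real.log y.1 + w₂ * Real.log y.2 =
        w₁ * Real.log (β * w₁ / (w₁ + w₂)) +
          w₂ * Real.log (β * w₂ / (α * (w₁ + w₂))) →
      y = (β * w₁ / (w₁ + w₂), β * w₂ / (α * (w₁ + w₂)))) := by
  obtain ⟨hr1, hr2⟩ := hr
  have hW : 0 < w₁ + w₂ := by linarith
  have hp : 0 < β * w₁ / (w₁ + w₂) := by positivity
  have hq : 0 < β * w₂ / (α * (w₁ + w₂)) := by positivity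
  have hpq : β * w₁ / (w₁ + w₂) + α * (β * w₂ / (α * (w₁ + w₂))) = β := by
    field_simp
  have hc1 : w₁ = ((w₁ + w₂) / β) * (β * w₁ / (w₁ + w₂)) := by field_simp
  have hc2 : w₂ = ((w₁ + w₂) / β * α) * (β * w₂ / (α * (w₁ + w₂))) := by field_simp
  have h1 : a₁ ≤ β * w₁ / (w₁ + w₂) := by
    rw [div_le_iff₀ hβ] at hr1
    calc a₁ ≤ _ := hr1
      _ = _ := by ring
  have h2 : β * w₁ / (w₁ + w₂) ≤ a₂ := by
    rw [le_div_iff₀ hβ] at hr2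
    calc _ = w₁ / (w₁ + w₂) * β := by ring
      _ ≤ _ := hr2
  have hcpos : 0 < (w₁ + w₂) / β := by positivity
  generalize β * w₁ / (w₁ + w₂) = p at *
  generalize β * w₂ / (α * (w₁ + w₂)) = q at *
  generalize (w₁ + w₂) / β = c at *
  have key : ∀ y ∈ N, c * (y.1 - p) + c * α * (y.2 - q) ≤ 0 := by
    intro y hy
    have h := (hN hy).2.2
    have : c * (y.1 + α * y.2 - (p + α * q)) ≤ 0 :=
      mul_nonpos_of_nonneg_of_nonpos hcpos.le (by linarith)
    linarith
  refine ⟨?_, ?_, ?_⟩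
  · have hd : 0 < a₂ - a₁ := by linarith
    refine ⟨(a₂ - p) / (a₂ - a₁), (p - a₁) / (a₂ - a₁),
      div_nonneg (by linarith) hd.le, div_nonneg (by linarith) hd.le, ?_, ?_⟩
    · field_simp
      ring
    · have e1 : b₁ = (β - a₁) / α := by field_simp; linarith
      have e2 : b₂ = (β - a₂) / α := by field_simp; linarith
      have e3 : q = (β - p) / α := by field_simp; linarith
      ext
      · simp only [Prod.fst_add, Prod.smul_fst, smul_eq_mul]
        field_simp
        ring
      · simp only [Prod.snd_add, Prod.smul_snd, smul_eq_mul]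
        rw [e1, e2, e3]
        field_simp
        ring
  · intro y hy hy1 hy2
    have := key y hy
    have := aux_le w₁ c p y.1 hw₁ hp hy1 hc1
    have := aux_le w₂ (c * α) q y.2 hw₂ hq hy2 hc2
    linarith
  · intro y hy hy1 hy2 he
    have hk := key y hy
    have l1 := aux_le w₁ c p y.1 hw₁ hp hy1 hc1
    have l2 := aux_le w₂ (c * α) q y.2 hw₂ hq hy2 hc2
    ext
    · by_contra hne
      have := aux_lt w₁ c p y.1 hw₁ hp hy1 hc1 hne
      linarith
    · by_contra hne
      have := aux_lt w₂ (c * α) q y.2 hw₂ hq hy2 hc2 hne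
      linarith
end

section
/- Let w₁, w₂ be positive reals, let 0 < α₁ < α₂, let (a, b) be a point with a > 0 and b > 0, and set β₁ = a + α₁·b and β₂ = a + α₂·b. Let N be a convex set with (a, b) ∈ N ⊆ {(y₁,y₂) : y₁ ≥ 0, y₂ ≥ 0, y₁ + α₁·y₂ ≤ β₁, y₁ + α₂·y₂ ≤ β₂}. If w₁/(w₁+w₂) ∈ [a/β₂, a/β₁], then (a, b) is the unique maximizer of g(y₁, y₂) = w₁·log y₁ + w₂·log y₂ over {(y₁, y₂) ∈ N : y₁ > 0, y₂ > 0}. -/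
/-- Lemma (test for a vertex): if `w₁/(w₁+w₂) ∈ [a/β₂, a/β₁]` then the vertex
`(a, b)`, at the intersection of the facets `y₁ + α₁·y₂ ≤ β₁` and
`y₁ + α₂·y₂ ≤ β₂`, is the unique maximizer of `g` over `N` intersected with
the open positive quadrant. -/
theorem stmt_7 (w₁ w₂ α₁ α₂ : ℝ) (hw₁ : 0 < w₁) (hw₂ : 0 < w₂)
    (hα₁ : 0 < α₁) (hα₁₂ : α₁ < α₂)
    (a b : ℝ) (ha : 0 < a) (hb : 0 < b)
    (N : Set (ℝ × ℝ)) (hconv : Convex ℝ N) (hab : (a, b) ∈ N)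
    (hN : N ⊆ {y : ℝ × ℝ | 0 ≤ y.1 ∧ 0 ≤ y.2 ∧
      y.1 + α₁ * y.2 ≤ a + α₁ * b ∧ y.1 + α₂ * y.2 ≤ a + α₂ * b})
    (hr : a / (a + α₂ * b) ≤ w₁ / (w₁ + w₂) ∧
          w₁ / (w₁ + w₂) ≤ a / (a + α₁ * b)) :
    (∀ y ∈ N, 0 < y.1 → 0 < y.2 →
      w₁ * Real.log y.1 + w₂ * Real.log y.2 ≤
        w₁ * Real.log a + w₂ * Real.log b) ∧
    (∀ y ∈ N, 0 < y.1 → 0 < y.2 →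
      w₁ * Real.log y.1 + w₂ * Real.log y.2 =
        w₁ * Real.log a + w₂ * Real.log b →
      y = (a, b)) := by
  obtain ⟨h1, h2⟩ := hr
  have hα₂ : 0 < α₂ := hα₁.trans hα₁₂
  rw [div_le_div_iff₀ (by positivity) (by positivity)] at h1 h2
  have k1 : a * w₂ ≤ w₁ * α₂ * b := by nlinarith
  have k2 : w₁ * α₁ * b ≤ a * w₂ := by nlinarith
  have key : ∀ y ∈ N, w₁ * (y.1 / a - 1) + w₂ * (y.2 / b - 1) ≤ 0 := by
    intro y hy
    obtain ⟨-, -, e1, e2⟩ := hN hy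
    have e : w₁ * b * (y.1 - a) + a * w₂ * (y.2 - b) ≤ 0 := by
      have hwb : 0 < w₁ * b := by positivity
      rcases le_total b y.2 with h | h
      · have t1 := mul_le_mul_of_nonneg_right k1 (sub_nonneg.2 h)
        have t2 := mul_le_mul_of_nonneg_left e2 hwb.le
        nlinarith
      · have t1 := mul_le_mul_of_nonneg_right k2 (sub_nonneg.2 h)
        have t2 := mul_le_mul_of_nonneg_left e1 hwb.le
        nlinarith
    have : w₁ * (y.1 / a - 1) + w₂ * (y.2 / b - 1)
        = (w₁ * b * (y.1 - a) + a * w₂ * (y.2 - b)) / (a * b) := by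
      field_simp
    rw [this]
    exact div_nonpos_of_nonpos_of_nonneg e (by positivity)
  have hlog : ∀ x c w : ℝ, 0 < x → 0 < c → 0 < w →
      w * Real.log x - w * Real.log c ≤ w * (x / c - 1) := by
    intro x c w hx hc hw
    have := Real.log_le_sub_one_of_pos (div_pos hx hc)
    rw [Real.log_div hx.ne' hc.ne'] at this
    nlinarith
  have hlog' : ∀ x c w : ℝ, 0 < x → 0 < c → 0 < w → x ≠ c →
      w * Real.log x - w * Real.log c < w * (x / c - 1) := by
    intro x c w hx hc hw hne
    have := Real.log_lt_sub_one_of_pos (div_pos hx hc)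
      (fun h => hne ((div_eq_one_iff_eq hc.ne').1 h))
    rw [Real.log_div hx.ne' hc.ne'] at this
    nlinarith
  refine ⟨fun y hy p1 p2 => ?_, fun y hy p1 p2 heq => ?_⟩
  · linarith [key y hy, hlog _ _ _ p1 ha hw₁, hlog _ _ _ p2 hb hw₂]
  · refine Prod.ext ?_ ?_
    · by_contra hne
      linarith [key y hy, hlog' _ _ _ p1 ha hw₁ hne, hlog _ _ _ p2 hb hw₂]
    · by_contra hne
      linarith [key y hy, hlog _ _ _ p1 ha hw₁, hlog' _ _ _ p2 hb hw₂ hne]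
end

section
/- Let A be an m×n matrix with rational entries, let b₁, b₂, e ∈ ℚᵐ, let c₁, c₂ be nonnegative rationals, and let w₁, w₂ be positive integers. Let Π = {(x, y₁, y₂) ∈ ℝⁿ × ℝ × ℝ : x ≥ 0, y₁ ≥ 0, y₂ ≥ 0, A·x + (y₁ + c₁)·b₁ + (y₂ + c₂)·b₂ ≤ e}. Suppose Π is bounded and contains a point with y₁ > 0 and y₂ > 0. Then there is a unique pair (y₁*, y₂*) maximizing w₁·log y₁ + w₂·log y₂ over the projections (y₁, y₂) of points of Π with y₁ > 0, y₂ > 0, and both y₁* and y₂* are rational numbers (hence the bargaining solution v₁ = y₁* + c₁, v₂ = y₂* + c₂ is rational). -/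
open Filter Topology in
lemma aux_ev (a s e : ℝ) (h : a ≤ e) (h0 : a = e → s = 0) :
    ∀ᶠ t : ℝ in 𝓝 0, a + t * s ≤ e := by
  rcases h.eq_or_lt with h1 | h1
  · simp [h0 h1, h]
  · have hc : Continuous fun t : ℝ => a + t * s := by fun_prop
    have : ∀ᶠ t : ℝ in 𝓝 0, a + t * s < e :=
      hc.continuousAt.eventually_lt continuousAt_const (by simpa using h1)
    exact this.mono fun _ h => h.le

lemma aux_mid {a b : ℝ} (ha : 0 < a) (hb : 0 < b) :
    Real.log a + Real.log b ≤ 2 * Real.log ((a + b) / 2) ∧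
    (a ≠ b → Real.log a + Real.log b < 2 * Real.log ((a + b) / 2)) := by
  have e : 2 * Real.log ((a + b) / 2) = Real.log (((a + b) / 2) ^ 2) := by
    rw [Real.log_pow]; norm_num
  rw [e, ← Real.log_mul ha.ne' hb.ne']
  constructor
  · apply Real.log_le_log (by positivity)
    nlinarith [sq_nonneg (a - b)]
  · intro h
    apply Real.log_lt_log (by positivity)
    have : 0 < (a - b) ^ 2 := by have := sub_ne_zero.2 h; positivity
    nlinarith

lemma aux_rat (y : ℝ) (h : ∀ φ : ℝ →ₗ[ℚ] ℚ, φ 1 = 0 → φ y = 0) : ∃ q : ℚ, y = (q : ℝ) := by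
  by_contra hn
  have hy : y ∉ Submodule.span ℚ {(1 : ℝ)} := by
    intro hm
    obtain ⟨q, hq⟩ := Submodule.mem_span_singleton.1 hm
    exact hn ⟨q, by rw [← hq, Rat.smul_def, mul_one]⟩
  obtain ⟨f, hf, hle⟩ := Submodule.exists_le_ker_of_notMem hy
  exact hf (h f (hle (Submodule.mem_span_singleton_self 1)))

lemma aux_phi (φ : ℝ →ₗ[ℚ] ℚ) (q : ℚ) (r : ℝ) : φ ((q : ℝ) * r) = q * φ r := by
  rw [← Rat.smul_def, map_smul, smul_eq_mul]
lemma aux_phi' (φ : ℝ →ₗ[ℚ] ℚ) (h : φ 1 = 0) (q : ℚ) : φ (q : ℝ) = 0 := by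
  have := aux_phi φ q 1
  rwa [mul_one, h, mul_zero] at this

open Finset in
/-- Theorem: every feasible game in LNB2 has a unique bargaining solution, and
this solution is rational. Here `Π` is the polyhedron (in the translated
variables `yᵢ = vᵢ - cᵢ`) of the convex program for the game, assumed bounded
and containing a point with `y₁ > 0` and `y₂ > 0`. -/
theorem stmt_9 (m n : ℕ) (A : Matrix (Fin m) (Fin n) ℚ)
    (b₁ b₂ e : Fin m → ℚ) (c₁ c₂ : ℚ) (hc₁ : 0 ≤ c₁) (hc₂ : 0 ≤ c₂)
    (w₁ w₂ : ℕ) (hw₁ : 0 < w₁) (hw₂ : 0 < w₂)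
    (P : Set ((Fin n → ℝ) × ℝ × ℝ))
    (hP : P = {xy : (Fin n → ℝ) × ℝ × ℝ |
      (∀ i, 0 ≤ xy.1 i) ∧ 0 ≤ xy.2.1 ∧ 0 ≤ xy.2.2 ∧
      ∀ j, (∑ i, (A j i : ℝ) * xy.1 i) + (xy.2.1 + (c₁ : ℝ)) * (b₁ j : ℝ) +
        (xy.2.2 + (c₂ : ℝ)) * (b₂ j : ℝ) ≤ (e j : ℝ)})
    (hbdd : Bornology.IsBounded P)
    (hfeas : ∃ xy ∈ P, 0 < xy.2.1 ∧ 0 < xy.2.2) :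
    ∃ y : ℝ × ℝ,
      (0 < y.1 ∧ 0 < y.2 ∧ (∃ x : Fin n → ℝ, (x, y.1, y.2) ∈ P) ∧
        ∀ z : ℝ × ℝ, 0 < z.1 → 0 < z.2 → (∃ x : Fin n → ℝ, (x, z.1, z.2) ∈ P) →
          (w₁ : ℝ) * Real.log z.1 + (w₂ : ℝ) * Real.log z.2 ≤
            (w₁ : ℝ) * Real.log y.1 + (w₂ : ℝ) * Real.log y.2) ∧
      (∀ y' : ℝ × ℝ,
        (0 < y'.1 ∧ 0 < y'.2 ∧ (∃ x : Fin n → ℝ, (x, y'.1, y'.2) ∈ P) ∧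
          ∀ z : ℝ × ℝ, 0 < z.1 → 0 < z.2 →
            (∃ x : Fin n → ℝ, (x, z.1, z.2) ∈ P) →
            (w₁ : ℝ) * Real.log z.1 + (w₂ : ℝ) * Real.log z.2 ≤
              (w₁ : ℝ) * Real.log y'.1 + (w₂ : ℝ) * Real.log y'.2) →
        y' = y) ∧
      (∃ q₁ q₂ : ℚ, y.1 = (q₁ : ℝ) ∧ y.2 = (q₂ : ℝ)) := by
  have hPm : ∀ x y₁ y₂, (x, y₁, y₂) ∈ P ↔ (∀ i, 0 ≤ x i) ∧ 0 ≤ y₁ ∧ 0 ≤ y₂ ∧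
      ∀ j, (∑ i, (A j i : ℝ) * x i) + (y₁ + (c₁ : ℝ)) * (b₁ j : ℝ) +
        (y₂ + (c₂ : ℝ)) * (b₂ j : ℝ) ≤ (e j : ℝ) := by
    intro x y₁ y₂; rw [hP]; rfl
  have hclosed : IsClosed P := by
    rw [hP]
    simp only [Set.setOf_and, Set.setOf_forall]
    refine IsClosed.inter (isClosed_iInter fun i => ?_) (IsClosed.inter ?_ (IsClosed.inter ?_
      (isClosed_iInter fun j => ?_)))
    all_goals exact isClosed_le (by fun_prop) (by fun_prop)
  have hcomp : IsCompact P := Metric.isCompact_of_isClosed_isBounded hclosed hbdd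
  obtain ⟨p0, hp0, h01, h02⟩ := hfeas
  obtain ⟨⟨x, y₁, y₂⟩, hxy, hmax⟩ := hcomp.exists_isMaxOn ⟨p0, hp0⟩
    (f := fun p : (Fin n → ℝ) × ℝ × ℝ => p.2.1 ^ w₁ * p.2.2 ^ w₂)
    (Continuous.continuousOn (by fun_prop))
  have hmem := (hPm _ _ _).1 hxy
  obtain ⟨hx, hy1, hy2, hA⟩ := hmem
  have hpos : 0 < y₁ ^ w₁ * y₂ ^ w₂ :=
    lt_of_lt_of_le (by positivity : 0 < p0.2.1 ^ w₁ * p0.2.2 ^ w₂) (hmax hp0)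
  have hy1' : 0 < y₁ := by
    rcases hy1.eq_or_lt with h | h
    · rw [← h, zero_pow hw₁.ne', zero_mul] at hpos; exact absurd hpos (lt_irrefl _)
    · exact h
  have hy2' : 0 < y₂ := by
    rcases hy2.eq_or_lt with h | h
    · rw [← h, zero_pow hw₂.ne', mul_zero] at hpos; exact absurd hpos (lt_irrefl _)
    · exact h
  have hlog : ∀ a b : ℝ, 0 < a → 0 < b →
      Real.log (a ^ w₁ * b ^ w₂) = w₁ * Real.log a + w₂ * Real.log b := by
    intro a b ha hb
    rw [Real.log_mul (by positivity) (by positivity), Real.log_pow, Real.log_pow]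
  have hopt : ∀ z : ℝ × ℝ, 0 < z.1 → 0 < z.2 → (∃ x : Fin n → ℝ, (x, z.1, z.2) ∈ P) →
          (w₁ : ℝ) * Real.log z.1 + (w₂ : ℝ) * Real.log z.2 ≤
            (w₁ : ℝ) * Real.log y₁ + (w₂ : ℝ) * Real.log y₂ := by
    rintro z h1 h2 ⟨x', hx'⟩
    rw [← hlog _ _ h1 h2, ← hlog _ _ hy1' hy2']
    exact Real.log_le_log (by positivity) (hmax hx')
  have hw₁' : (0 : ℝ) < w₁ := by exact_mod_cast hw₁
  have hw₂' : (0 : ℝ) < w₂ := by exact_mod_cast hw₂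
  refine ⟨(y₁, y₂), ⟨hy1', hy2', ⟨x, hxy⟩, hopt⟩, ?_, ?_⟩
  · rintro ⟨z₁, z₂⟩ ⟨hz1, hz2, ⟨x', hx'⟩, hzopt⟩
    simp only at hz1 hz2 hx' hzopt
    have hq := hzopt (y₁, y₂) hy1' hy2' ⟨x, hxy⟩
    have hm : ((fun i => (x i + x' i) / 2), (y₁ + z₁) / 2, (y₂ + z₂) / 2) ∈ P := by
      obtain ⟨g1, g2, g3, g4⟩ := (hPm _ _ _).1 hx'
      refine (hPm _ _ _).2 ⟨fun i => ?_, by linarith, by linarith, fun j => ?_⟩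
      · have := hx i; have := g1 i; linarith
      · have h1 := hA j
        have h2 := g4 j
        have h3 : ∑ i, (A j i : ℝ) * ((x i + x' i) / 2) =
            ((∑ i, (A j i : ℝ) * x i) + ∑ i, (A j i : ℝ) * x' i) / 2 := by
          rw [← Finset.sum_add_distrib, Finset.sum_div]
          exact Finset.sum_congr rfl fun i _ => by ring
        rw [h3]; linarith
    have hmo := hopt ((y₁ + z₁) / 2, (y₂ + z₂) / 2) (by positivity) (by positivity) ⟨_, hm⟩
    simp only at hmo hq
    obtain ⟨k1, k1'⟩ := aux_mid hy1' hz1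
    obtain ⟨k2, k2'⟩ := aux_mid hy2' hz2
    have k1m := mul_le_mul_of_nonneg_left k1 hw₁'.le
    have k2m := mul_le_mul_of_nonneg_left k2 hw₂'.le
    refine Prod.ext ?_ ?_
    · by_contra hne
      have := mul_lt_mul_of_pos_left (k1' (Ne.symm hne)) hw₁'
      linarith
    · by_contra hne
      have := mul_lt_mul_of_pos_left (k2' (Ne.symm hne)) hw₂'
      linarith
  · have key : ∀ φ : ℝ →ₗ[ℚ] ℚ, φ 1 = 0 → φ y₁ = 0 ∧ φ y₂ = 0 := by
      intro φ h1
      have evx : ∀ᶠ t : ℝ in nhds 0, ∀ i, 0 ≤ x i + t * (φ (x i) : ℝ) := by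
        rw [Filter.eventually_all]
        intro i
        have := aux_ev (- x i) (- (φ (x i) : ℝ)) 0 (by linarith [hx i]) (fun h => by
          rw [neg_eq_zero.1 h]; simp)
        exact this.mono fun t ht => by linarith
      have ev1 : ∀ᶠ t : ℝ in nhds 0, 0 < y₁ + t * (φ y₁ : ℝ) :=
        continuousAt_const.eventually_lt (Continuous.continuousAt (by fun_prop)) (by simpa)
      have ev2 : ∀ᶠ t : ℝ in nhds 0, 0 < y₂ + t * (φ y₂ : ℝ) :=
        continuousAt_const.eventually_lt (Continuous.continuousAt (by fun_prop)) (by simpa)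
      have evA : ∀ᶠ t : ℝ in nhds 0, ∀ j, ((∑ i, (A j i : ℝ) * x i) +
          (y₁ + (c₁ : ℝ)) * (b₁ j : ℝ) + (y₂ + (c₂ : ℝ)) * (b₂ j : ℝ)) +
          t * ((∑ i, (A j i : ℝ) * (φ (x i) : ℝ)) + (φ y₁ : ℝ) * (b₁ j : ℝ) +
            (φ y₂ : ℝ) * (b₂ j : ℝ)) ≤ (e j : ℝ) := by
        rw [Filter.eventually_all]
        intro j
        refine aux_ev _ _ _ (hA j) fun h => ?_
        have h' : (∑ i, (A j i : ℝ) * x i) + (b₁ j : ℝ) * y₁ + (b₂ j : ℝ) * y₂ =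
            ((e j - c₁ * b₁ j - c₂ * b₂ j : ℚ) : ℝ) := by
          push_cast; linarith
        have h2 := congrArg φ h'
        rw [aux_phi' φ h1, map_add, map_add, map_sum, aux_phi, aux_phi] at h2
        simp only [aux_phi] at h2
        have h3 : ((∑ i, A j i * φ (x i) + b₁ j * φ y₁ + b₂ j * φ y₂ : ℚ) : ℝ) = 0 := by
          rw [h2]; simp
        push_cast at h3
        linarith
      have hlm : IsLocalMax (fun t : ℝ => (w₁ : ℝ) * Real.log (y₁ + t * (φ y₁ : ℝ)) +
          (w₂ : ℝ) * Real.log (y₂ + t * (φ y₂ : ℝ))) 0 := by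
        filter_upwards [evx, ev1, ev2, evA] with t tx t1 t2 tA
        simp only [zero_mul, add_zero]
        refine hopt (y₁ + t * (φ y₁ : ℝ), y₂ + t * (φ y₂ : ℝ)) t1 t2
          ⟨fun i => x i + t * (φ (x i) : ℝ), (hPm _ _ _).2 ⟨tx, t1.le, t2.le, fun j => ?_⟩⟩
        have := tA j
        have h3 : ∑ i, (A j i : ℝ) * (x i + t * (φ (x i) : ℝ)) =
            (∑ i, (A j i : ℝ) * x i) + t * ∑ i, (A j i : ℝ) * (φ (x i) : ℝ) := by
          rw [Finset.mul_sum, ← Finset.sum_add_distrib]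
          exact Finset.sum_congr rfl fun i _ => by ring
        rw [h3]; linarith
      have hd : ∀ y d : ℝ, 0 < y → HasDerivAt (fun t : ℝ => Real.log (y + t * d)) (d / y) 0 := by
        intro y d hy
        have h0 : HasDerivAt (fun t : ℝ => y + t * d) d 0 := by
          simpa using ((hasDerivAt_id (0 : ℝ)).mul_const d).const_add y
        simpa using h0.log (by simpa using hy.ne')
      have hz := hlm.hasDerivAt_eq_zero
        (((hd y₁ (φ y₁) hy1').const_mul (w₁ : ℝ)).add ((hd y₂ (φ y₂) hy2').const_mul (w₂ : ℝ)))
      field_simp at hz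
      have hz2 : (((w₁ : ℚ) * φ y₁ : ℚ) : ℝ) * y₂ + (((w₂ : ℚ) * φ y₂ : ℚ) : ℝ) * y₁ = 0 := by
        push_cast; linarith
      have hz3 := congrArg φ hz2
      rw [map_add, aux_phi, aux_phi, map_zero] at hz3
      have hw : ((w₁ : ℚ) + w₂) ≠ 0 := by positivity
      have hprod : φ y₁ * φ y₂ = 0 := by
        have : ((w₁ : ℚ) + w₂) * (φ y₁ * φ y₂) = 0 := by linarith
        exact (mul_eq_zero.1 this).resolve_left hw
      rcases mul_eq_zero.1 hprod with h | h
      · refine ⟨h, ?_⟩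
        rw [h] at hz2
        simpa [hw₂.ne', hy1'.ne'] using hz2
      · refine ⟨?_, h⟩
        rw [h] at hz2
        simpa [hw₁.ne', hy2'.ne'] using hz2
    obtain ⟨q₁, h₁⟩ := aux_rat y₁ fun φ h => (key φ h).1
    obtain ⟨q₂, h₂⟩ := aux_rat y₂ fun φ h => (key φ h).2
    exact ⟨q₁, q₂, h₁, h₂⟩
end

section
/- Let c₁, c₂ ≥ 0 with c₁² + c₂² < 1, and let (x, y) be the maximizer of (v₁ − c₁)·(v₂ − c₂) over the set {(v₁, v₂) ∈ ℝ² : v₁ ≥ c₁, v₂ ≥ c₂, v₁² + v₂² ≤ 1}. Then x² + y² = 1 and (2y² − c₂·y − 1)² = c₁²·(1 − y²). -/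
/-- The Nash bargaining solution `(x, y)` of the circle game lies on the unit
circle and satisfies `(2y² − c₂·y − 1)² = c₁²·(1 − y²)`. -/
theorem stmt_10 (c₁ c₂ : ℝ) (hc₁ : 0 ≤ c₁) (hc₂ : 0 ≤ c₂)
    (hc : c₁ ^ 2 + c₂ ^ 2 < 1)
    (x y : ℝ) (hx : c₁ ≤ x) (hy : c₂ ≤ y) (hxy : x ^ 2 + y ^ 2 ≤ 1)
    (hmax : ∀ v₁ v₂ : ℝ, c₁ ≤ v₁ → c₂ ≤ v₂ → v₁ ^ 2 + v₂ ^ 2 ≤ 1 →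
      (v₁ - c₁) * (v₂ - c₂) ≤ (x - c₁) * (y - c₂)) :
    x ^ 2 + y ^ 2 = 1 ∧
    (2 * y ^ 2 - c₂ * y - 1) ^ 2 = c₁ ^ 2 * (1 - y ^ 2) := by
  have hc1 : c₁ ≤ 1 := by nlinarith
  have hc2 : c₂ ≤ 1 := by nlinarith
  have hpos : 0 < (x - c₁) * (y - c₂) := by
    obtain ⟨e, he⟩ : ∃ e, e = (1 - c₁ ^ 2 - c₂ ^ 2) / 8 := ⟨_, rfl⟩
    have he0 : 0 < e := by linarith
    have he1 : e ≤ 1 / 8 := by nlinarith [sq_nonneg c₁, sq_nonneg c₂]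
    have h := hmax (c₁ + e) (c₂ + e) (by linarith) (by linarith) (by
      nlinarith [mul_le_mul_of_nonneg_left hc1 he0.le, mul_le_mul_of_nonneg_left hc2 he0.le,
        mul_le_mul_of_nonneg_left he1 he0.le])
    nlinarith [mul_pos he0 he0]
  have hx' : c₁ < x := by
    rcases hx.lt_or_eq with h | h
    · exact h
    · simp [h] at hpos
  have hy' : c₂ < y := by
    rcases hy.lt_or_eq with h | h
    · exact h
    · simp [h] at hpos
  have h1 : x ^ 2 + y ^ 2 = 1 := by
    by_contra hne
    have hlt := lt_of_le_of_ne hxy hne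
    have hx1 : x ≤ 1 := by nlinarith
    obtain ⟨e, he⟩ : ∃ e, e = (1 - x ^ 2 - y ^ 2) / 4 := ⟨_, rfl⟩
    have he0 : 0 < e := by linarith
    have he1 : e ≤ 1 := by nlinarith [sq_nonneg x, sq_nonneg y]
    have h := hmax (x + e) y (by linarith) hy (by
      nlinarith [mul_le_mul_of_nonneg_left hx1 he0.le, mul_le_mul_of_nonneg_left he1 he0.le])
    nlinarith [mul_pos he0 (sub_pos.2 hy')]
  refine ⟨h1, ?_⟩
  have hA : HasDerivAt (fun t : ℝ => x * Real.cos t - y * Real.sin t - c₁)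
      (x * (-Real.sin 0) - y * Real.cos 0) 0 :=
    (((Real.hasDerivAt_cos 0).const_mul x).sub ((Real.hasDerivAt_sin 0).const_mul y)).sub_const c₁
  have hB : HasDerivAt (fun t : ℝ => x * Real.sin t + y * Real.cos t - c₂)
      (x * Real.cos 0 + y * (-Real.sin 0)) 0 :=
    (((Real.hasDerivAt_sin 0).const_mul x).add ((Real.hasDerivAt_cos 0).const_mul y)).sub_const c₂
  have hloc : IsLocalMax ((fun t : ℝ => x * Real.cos t - y * Real.sin t - c₁) *
      (fun t : ℝ => x * Real.sin t + y * Real.cos t - c₂)) 0 := by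
    have e1 := hA.continuousAt.eventually_const_lt (u := 0) (by simpa using hx')
    have e2 := hB.continuousAt.eventually_const_lt (u := 0) (by simpa using hy')
    filter_upwards [e1, e2] with t h1' h2'
    have h := hmax (x * Real.cos t - y * Real.sin t) (x * Real.sin t + y * Real.cos t)
      (by linarith) (by linarith) (by
        have : (x * Real.cos t - y * Real.sin t) ^ 2 + (x * Real.sin t + y * Real.cos t) ^ 2
          = (x ^ 2 + y ^ 2) * (Real.sin t ^ 2 + Real.cos t ^ 2) := by ring
        rw [this, Real.sin_sq_add_cos_sq, h1]; norm_num)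
    simpa using h
  have h0 := hloc.hasDerivAt_eq_zero (hA.mul hB)
  simp at h0
  have h2 : 2 * y ^ 2 - c₂ * y - 1 = -(c₁ * x) := by linarith
  rw [h2]
  have h3 : 1 - y ^ 2 = x ^ 2 := by linarith
  rw [h3]; ring
end

section
/- Let c₁, c₂ ≥ 0 with c₁² + c₂² < 1, and let Q = (a, b) be a point with a² + b² = 1, a > c₁ and b > c₂. Then Q is the Nash bargaining solution of the circle game — i.e., Q is the unique maximizer of (v₁ − c₁)·(v₂ − c₂) over {(v₁, v₂) ∈ ℝ² : v₁ ≥ c₁, v₂ ≥ c₂, v₁² + v₂² ≤ 1} — if and only if (b − c₂)/(a − c₁) = a/b; equivalently, the angle θ₁ that the segment from P = (c₁, c₂) to Q makes with the x-axis equals the angle θ₂ that the segment from the origin O to Q makes with the y-axis. -/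
/-- Geometric characterization of the solution to the circle game: a point
`Q = (a, b)` on the unit circle strictly dominating the disagreement point
`P = (c₁, c₂)` is the (unique) Nash bargaining solution iff
`(b − c₂)/(a − c₁) = a/b`, equivalently iff the angle `θ₁` that `PQ` makes
with the x-axis equals the angle `θ₂` that `OQ` makes with the y-axis. -/
theorem stmt_11 (c₁ c₂ : ℝ) (hc₁ : 0 ≤ c₁) (hc₂ : 0 ≤ c₂)
    (hc : c₁ ^ 2 + c₂ ^ 2 < 1)
    (a b : ℝ) (hQ : a ^ 2 + b ^ 2 = 1) (ha : c₁ < a) (hb : c₂ < b) :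
    (((∀ v₁ v₂ : ℝ, c₁ ≤ v₁ → c₂ ≤ v₂ → v₁ ^ 2 + v₂ ^ 2 ≤ 1 →
        (v₁ - c₁) * (v₂ - c₂) ≤ (a - c₁) * (b - c₂)) ∧
      (∀ v₁ v₂ : ℝ, c₁ ≤ v₁ → c₂ ≤ v₂ → v₁ ^ 2 + v₂ ^ 2 ≤ 1 →
        (v₁ - c₁) * (v₂ - c₂) = (a - c₁) * (b - c₂) → v₁ = a ∧ v₂ = b)) ↔
      (b - c₂) / (a - c₁) = a / b) ∧
    ((b - c₂) / (a - c₁) = a / b ↔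
      Real.arctan ((b - c₂) / (a - c₁)) = Real.arctan (a / b)) := by
  have hA : 0 < a - c₁ := by linarith
  have hB : 0 < b - c₂ := by linarith
  have ha0 : 0 < a := by linarith
  have hb0 : 0 < b := by linarith
  refine ⟨?_, ⟨fun h => by rw [h], fun h => Real.arctan_injective h⟩⟩
  rw [div_eq_div_iff hA.ne' hb0.ne']
  constructor
  · rintro ⟨hmax, -⟩
    have h1 : HasDerivAt (fun t : ℝ => a * Real.cos t - b * Real.sin t - c₁)
        (a * (-Real.sin 0) - b * Real.cos 0) 0 :=
      (((Real.hasDerivAt_cos 0).const_mul a).sub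
        ((Real.hasDerivAt_sin 0).const_mul b)).sub_const c₁
    have h2 : HasDerivAt (fun t : ℝ => b * Real.cos t + a * Real.sin t - c₂)
        (b * (-Real.sin 0) + a * Real.cos 0) 0 :=
      (((Real.hasDerivAt_cos 0).const_mul b).add
        ((Real.hasDerivAt_sin 0).const_mul a)).sub_const c₂
    have h3 := h1.mul h2
    have e1 : ∀ᶠ t in nhds (0:ℝ), 0 < a * Real.cos t - b * Real.sin t - c₁ :=
      h1.continuousAt.eventually (lt_mem_nhds (by simpa using ha))
    have e2 : ∀ᶠ t in nhds (0:ℝ), 0 < b * Real.cos t + a * Real.sin t - c₂ :=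
      h2.continuousAt.eventually (lt_mem_nhds (by simpa using hb))
    have hloc : IsLocalMax ((fun t : ℝ => a * Real.cos t - b * Real.sin t - c₁) *
        (fun t : ℝ => b * Real.cos t + a * Real.sin t - c₂)) 0 := by
      filter_upwards [e1, e2] with t h1 h2
      have := hmax (a * Real.cos t - b * Real.sin t) (b * Real.cos t + a * Real.sin t)
        (by linarith) (by linarith) (by
          have h := Real.sin_sq_add_cos_sq t
          have : (a * Real.cos t - b * Real.sin t) ^ 2 + (b * Real.cos t + a * Real.sin t) ^ 2
            = (a ^ 2 + b ^ 2) * (Real.sin t ^ 2 + Real.cos t ^ 2) := by ring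
          rw [this, h, hQ]; norm_num)
      simpa using this
    have h4 := hloc.hasDerivAt_eq_zero h3
    simp at h4
    linarith
  · intro h
    have key : ∀ v₁ v₂ : ℝ, v₁ ^ 2 + v₂ ^ 2 ≤ 1 →
        a * (v₁ - c₁) + b * (v₂ - c₂) ≤ 2 * (a * (a - c₁)) := by
      intro v₁ v₂ hv
      nlinarith [sq_nonneg (v₁ - a), sq_nonneg (v₂ - b)]
    have hab : 0 < a * b := mul_pos ha0 hb0
    have hS : 0 < a * (a - c₁) := mul_pos ha0 hA
    have hAB : a * b * ((a - c₁) * (b - c₂)) = (a * (a - c₁)) ^ 2 := by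
      linear_combination a * (a - c₁) * h
    constructor
    · intro v₁ v₂ h1 h2 hv
      have k := key v₁ v₂ hv
      have p : 0 ≤ a * (v₁ - c₁) := mul_nonneg ha0.le (by linarith)
      have q : 0 ≤ b * (v₂ - c₂) := mul_nonneg hb0.le (by linarith)
      refine le_of_mul_le_mul_left ?_ hab
      rw [hAB]
      have e : a * b * ((v₁ - c₁) * (v₂ - c₂)) = (a * (v₁ - c₁)) * (b * (v₂ - c₂)) := by ring
      rw [e]
      nlinarith [sq_nonneg (a * (v₁ - c₁) - b * (v₂ - c₂))]
    · intro v₁ v₂ h1 h2 hv heq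
      have k := key v₁ v₂ hv
      have p : 0 ≤ a * (v₁ - c₁) := mul_nonneg ha0.le (by linarith)
      have q : 0 ≤ b * (v₂ - c₂) := mul_nonneg hb0.le (by linarith)
      have e : (a * (v₁ - c₁)) * (b * (v₂ - c₂)) = (a * (a - c₁)) ^ 2 := by
        rw [← hAB, ← heq]; ring
      have hd : (a * (v₁ - c₁) - b * (v₂ - c₂)) ^ 2 = 0 := by
        apply le_antisymm _ (sq_nonneg _)
        nlinarith
      have hd' := pow_eq_zero_iff (two_ne_zero) |>.mp hd
      have hxy : b * (v₂ - c₂) = a * (v₁ - c₁) := by linarith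
      rw [hxy] at e
      have hx : a * (v₁ - c₁) = a * (a - c₁) := by
        rw [← pow_left_inj₀ p hS.le two_ne_zero, ← e]; ring
      have hy : b * (v₂ - c₂) = b * (b - c₂) := by linarith
      have := mul_left_cancel₀ ha0.ne' hx
      have := mul_left_cancel₀ hb0.ne' hy
      constructor <;> linarith
end

section
/- Let there be n goods with available amounts b₁, …, bₙ > 0 and utilities u₁ⱼ > 0 (player 1) and u₂ⱼ > 0 (player 2) such that the ratios u₁ⱼ/u₂ⱼ are strictly decreasing in j. For any allocation x₁, x₂ ∈ ℝⁿ with x₁ⱼ ≥ 0, x₂ⱼ ≥ 0 and x₁ⱼ + x₂ⱼ ≤ bⱼ for all j, there exist an index k ∈ {1, …, n} and an allocation x̂₁, x̂₂ ∈ ℝⁿ with x̂₁ⱼ ≥ 0, x̂₂ⱼ ≥ 0, x̂₁ⱼ + x̂₂ⱼ ≤ bⱼ for all j, such that x̂₁ⱼ = 0 for all j > k, x̂₂ⱼ = 0 for all j < k, Σⱼ u₁ⱼ·x̂₁ⱼ ≥ Σⱼ u₁ⱼ·x₁ⱼ, and Σⱼ u₂ⱼ·x̂₂ⱼ ≥ Σⱼ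 u₂ⱼ·x₂ⱼ. -/
open Finset in
/-- In ADNB2, any feasible allocation is weakly dominated (in both players'
utilities) by an allocation in which player 1 receives only goods from a prefix
`{1, …, k}` and player 2 only goods from the suffix `{k, …, n}`, so that at
most good `k` is shared. -/
theorem stmt_12 (n : ℕ) (hn : 0 < n) (b u₁ u₂ : Fin n → ℝ)
    (hb : ∀ j, 0 < b j) (hu₁ : ∀ j, 0 < u₁ j) (hu₂ : ∀ j, 0 < u₂ j)
    (hdec : ∀ j k : Fin n, j < k → u₁ k / u₂ k < u₁ j / u₂ j)
    (x₁ x₂ : Fin n → ℝ) (hx₁ : ∀ j, 0 ≤ x₁ j) (hx₂ : ∀ j, 0 ≤ x₂ j)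
    (hcap : ∀ j, x₁ j + x₂ j ≤ b j) :
    ∃ (k : Fin n) (y₁ y₂ : Fin n → ℝ),
      (∀ j, 0 ≤ y₁ j) ∧ (∀ j, 0 ≤ y₂ j) ∧ (∀ j, y₁ j + y₂ j ≤ b j) ∧
      (∀ j, k < j → y₁ j = 0) ∧ (∀ j, j < k → y₂ j = 0) ∧
      (∑ j, u₁ j * x₁ j) ≤ (∑ j, u₁ j * y₁ j) ∧
      (∑ j, u₂ j * x₂ j) ≤ (∑ j, u₂ j * y₂ j) := by
  classical
  obtain ⟨P, hP⟩ : ∃ P : ℕ → ℝ, ∀ m, P m = ∑ j : Fin n, if j.val < m then u₁ j * b j else 0 :=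
    ⟨_, fun _ => rfl⟩
  obtain ⟨U, hU⟩ : ∃ U : ℝ, U = ∑ j, u₁ j * x₁ j := ⟨_, rfl⟩
  have hP0 : P 0 = 0 := by simp [hP]
  have hU0 : 0 ≤ U := by
    rw [hU]; exact Finset.sum_nonneg fun j _ => mul_nonneg (hu₁ j).le (hx₁ j)
  have hPn : U ≤ P (n - 1 + 1) := by
    rw [hU, hP]
    apply Finset.sum_le_sum
    intro j _
    have hj : j.val < n - 1 + 1 := by have := j.isLt; omega
    rw [if_pos hj]
    exact mul_le_mul_of_nonneg_left (by linarith [hcap j, hx₂ j]) (hu₁ j).le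
  have hex : ∃ m, U ≤ P (m + 1) := ⟨_, hPn⟩
  obtain ⟨m, hm1, hm2, hmn⟩ : ∃ m, U ≤ P (m + 1) ∧ P m ≤ U ∧ m < n := by
    refine ⟨Nat.find hex, Nat.find_spec hex, ?_, ?_⟩
    · rcases h : Nat.find hex with _ | q
      · rw [hP0]; exact hU0
      · have := Nat.find_min hex (m := q) (by omega)
        exact (not_le.mp this).le
    · have := Nat.find_min' hex hPn
      omega
  obtain ⟨k, hk⟩ : ∃ k : Fin n, k.val = m := ⟨⟨m, hmn⟩, rfl⟩
  have hstep : P (m + 1) = P m + u₁ k * b k := by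
    have h : u₁ k * b k = ∑ j : Fin n, if j = k then u₁ j * b j else 0 := by simp
    rw [h, hP, hP, ← Finset.sum_add_distrib]
    apply Finset.sum_congr rfl
    intro j _
    have : j = k ↔ j.val = m := by rw [Fin.ext_iff, hk]
    simp only [this]
    split_ifs <;> first | omega | simp
  have huk := hu₁ k
  obtain ⟨t, ht⟩ : ∃ t, t = (U - P m) / u₁ k := ⟨_, rfl⟩
  have htk : u₁ k * t = U - P m := by rw [ht]; field_simp
  have ht0 : 0 ≤ t := by rw [ht]; exact div_nonneg (by linarith) huk.le
  have htb : t ≤ b k := by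
    rw [ht, div_le_iff₀ huk]; linarith
  obtain ⟨y, hy⟩ : ∃ y : Fin n → ℝ, ∀ j, y j = if j.val < m then b j else if j = k then t else 0 :=
    ⟨_, fun _ => rfl⟩
  have hylt : ∀ j, j < k → y j = b j := by
    intro j hj
    rw [hy, if_pos (by rw [← hk]; exact hj)]
  have hyk : y k = t := by rw [hy, if_neg (by omega), if_pos rfl]
  have hygt : ∀ j, k < j → y j = 0 := by
    intro j hj
    rw [hy, if_neg (by have : k.val < j.val := hj
                       omega), if_neg hj.ne']
  have hy0 : ∀ j, 0 ≤ y j := by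
    intro j
    rcases lt_trichotomy j k with h | h | h
    · rw [hylt j h]; exact (hb j).le
    · rw [h, hyk]; exact ht0
    · rw [hygt j h]
  have hyb : ∀ j, y j ≤ b j := by
    intro j
    rcases lt_trichotomy j k with h | h | h
    · rw [hylt j h]
    · rw [h, hyk]; exact htb
    · rw [hygt j h]; exact (hb j).le
  have hsum : ∑ j, u₁ j * y j = U := by
    have h : U = P m + ∑ j : Fin n, if j = k then u₁ j * t else 0 := by
      simp only [Finset.sum_ite_eq', Finset.mem_univ, if_true]; linarith
    rw [h, hP, ← Finset.sum_add_distrib]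
    apply Finset.sum_congr rfl
    intro j _
    rw [hy]
    have : j = k ↔ j.val = m := by rw [Fin.ext_iff, hk]
    simp only [this]
    split_ifs <;> first | omega | simp
  refine ⟨k, y, fun j => b j - y j, hy0, fun j => sub_nonneg.mpr (hyb j), fun j => by simp,
    hygt, fun j hj => by simp [hylt j hj], by rw [hsum, hU], ?_⟩
  have hcross : ∀ i j : Fin n, i < j → u₁ j * u₂ i ≤ u₁ i * u₂ j := by
    intro i j hij
    exact ((div_lt_div_iff₀ (hu₂ j) (hu₂ i)).mp (hdec i j hij)).le
  have key : ∀ j, u₁ k * (u₂ j * (y j - x₁ j)) ≤ u₂ k * (u₁ j * (y j - x₁ j)) := by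
    intro j
    rcases lt_trichotomy j k with h | h | h
    · have h1 : 0 ≤ y j - x₁ j := by rw [hylt j h]; linarith [hcap j, hx₂ j]
      nlinarith [mul_le_mul_of_nonneg_right (hcross j k h) h1]
    · rw [h]; apply le_of_eq; ring
    · have h1 : 0 ≤ x₁ j - y j := by rw [hygt j h]; linarith [hx₁ j]
      nlinarith [mul_le_mul_of_nonneg_right (hcross k j h) h1]
  have hs := Finset.sum_le_sum fun j (_ : j ∈ Finset.univ) => key j
  rw [← Finset.mul_sum, ← Finset.mul_sum] at hs
  have hz : ∑ j, u₁ j * (y j - x₁ j) = 0 := by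
    simp only [mul_sub, Finset.sum_sub_distrib]; rw [hsum, hU]; ring
  rw [hz, mul_zero] at hs
  have hs' : ∑ j, u₂ j * (y j - x₁ j) ≤ 0 := by
    by_contra hc
    have := mul_pos huk (not_le.mp hc)
    linarith
  have hfin : ∑ j, u₂ j * x₂ j ≤ ∑ j, (u₂ j * (b j - y j) + u₂ j * (y j - x₁ j)) := by
    apply Finset.sum_le_sum
    intro j _
    rw [← mul_add]
    exact mul_le_mul_of_nonneg_left (by linarith [hcap j]) (hu₂ j).le
  rw [Finset.sum_add_distrib] at hfin
  linarith
end

section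
/- Let there be n goods with available amounts b₁, …, bₙ > 0 and utilities u₁ⱼ > 0 (player 1) and u₂ⱼ > 0 (player 2) such that the ratios u₁ⱼ/u₂ⱼ are strictly decreasing in j. Let p₁, …, pₙ > 0 be prices and let x₁, x₂ ∈ ℝⁿ be an allocation with x₁ⱼ ≥ 0, x₂ⱼ ≥ 0, such that each player buys only maximum bang-per-buck goods: for i = 1, 2, if xᵢⱼ > 0 then uᵢⱼ/pⱼ = max over l of uᵢₗ/pₗ. Then there exists an index k ∈ {1, …, n} such that x₁ⱼ = 0 for all j > k and x₂ⱼ = 0 for all j < k; i.e., player 1 receives only goods in {1, …, k} and player 2 only goods in {k, …, n}, with at most the single good k shared. -/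
/-- In the flexible budget market for ADNB2, if at prices `p` each buyer is
allocated only goods attaining her maximum bang-per-buck, then buyer 1
receives only goods from a prefix `{1, …, k}` and buyer 2 only goods from the
suffix `{k, …, n}`, with at most the single good `k` shared. -/
theorem stmt_13 (n : ℕ) (hn : 0 < n) (b u₁ u₂ : Fin n → ℝ)
    (hb : ∀ j, 0 < b j) (hu₁ : ∀ j, 0 < u₁ j) (hu₂ : ∀ j, 0 < u₂ j)
    (hdec : ∀ j k : Fin n, j < k → u₁ k / u₂ k < u₁ j / u₂ j)
    (p : Fin n → ℝ) (hp : ∀ j, 0 < p j)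
    (x₁ x₂ : Fin n → ℝ) (hx₁ : ∀ j, 0 ≤ x₁ j) (hx₂ : ∀ j, 0 ≤ x₂ j)
    (hbpb₁ : ∀ j, 0 < x₁ j → ∀ l, u₁ l / p l ≤ u₁ j / p j)
    (hbpb₂ : ∀ j, 0 < x₂ j → ∀ l, u₂ l / p l ≤ u₂ j / p j) :
    ∃ k : Fin n, (∀ j, k < j → x₁ j = 0) ∧ (∀ j, j < k → x₂ j = 0) := by
  have key : ∀ i j, 0 < x₂ i → 0 < x₁ j → ¬ i < j := by
    intro i j hi hj hij
    have h1 := hbpb₁ j hj i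
    have h2 := hbpb₂ i hi j
    have h3 := hdec i j hij
    rw [div_le_div_iff₀ (hp _) (hp _)] at h1 h2
    rw [div_lt_div_iff₀ (hu₂ _) (hu₂ _)] at h3
    have h4 := mul_le_mul h1 h2 (mul_pos (hu₂ j) (hp i)).le (mul_pos (hu₁ j) (hp i)).le
    have h5 := mul_lt_mul_of_pos_right h3 (mul_pos (hp i) (hp j))
    linarith
  by_cases h : ∃ j, 0 < x₁ j
  · obtain ⟨k, hk, hmax⟩ := Finset.exists_max_image
      (Finset.univ.filter fun j => 0 < x₁ j) id (by
        obtain ⟨j, hj⟩ := h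
        exact ⟨j, by simp [hj]⟩)
    simp only [Finset.mem_filter, Finset.mem_univ, true_and, id] at hk hmax
    refine ⟨k, fun j hj => ?_, fun j hj => ?_⟩
    · by_contra hne
      exact absurd (hmax j (lt_of_le_of_ne (hx₁ j) (Ne.symm hne))) (not_le.mpr hj)
    · by_contra hne
      exact key j k (lt_of_le_of_ne (hx₂ j) (Ne.symm hne)) hk hj
  · push Not at h
    refine ⟨⟨0, hn⟩, fun j _ => le_antisymm (h j) (hx₁ j), fun j hj => ?_⟩
    exact absurd hj (by simp [Fin.lt_def])
end

section
/- Let w₁, w₂ be positive reals and let N ⊆ ℝ² be a compact convex set contained in the nonnegative orthant that contains a point with both coordinates positive. Define l₁ = max{y₁ : (y₁, y₂) ∈ N for some y₂}, l₂ = max{y₂ : (l₁, y₂) ∈ N}, h₂ = max{y₂ : (y₁, y₂) ∈ N for some y₁}, and h₁ = max{y₁ : (y₁, h₂) ∈ N}. Then the maximizer (f₁, f₂) of g(y₁, y₂) = w₁·log y₁ + w₂·log y₂ over {(y₁, y₂) ∈ N : y₁ > 0, y₂ > 0} satisfies h₁ ≤ f₁ ≤ l₁ and l₂ ≤ f₂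 ≤ h₂. -/
/-- The bargaining solution `(f₁, f₂)` lies on the portion of the boundary of
`N` between the points `(l₁, l₂)` (maximize `y₁`, then `y₂`) and `(h₁, h₂)`
(maximize `y₂`, then `y₁`): it satisfies `h₁ ≤ f₁ ≤ l₁` and `l₂ ≤ f₂ ≤ h₂`. -/
theorem stmt_14 (w₁ w₂ : ℝ) (hw₁ : 0 < w₁) (hw₂ : 0 < w₂)
    (N : Set (ℝ × ℝ)) (hcpt : IsCompact N) (hconv : Convex ℝ N)
    (hNpos : N ⊆ {y : ℝ × ℝ | 0 ≤ y.1 ∧ 0 ≤ y.2})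
    (hfeas : ∃ y ∈ N, 0 < y.1 ∧ 0 < y.2)
    (l₁ l₂ h₁ h₂ : ℝ)
    (hl₁ : IsGreatest {y₁ : ℝ | ∃ y₂ : ℝ, (y₁, y₂) ∈ N} l₁)
    (hl₂ : IsGreatest {y₂ : ℝ | (l₁, y₂) ∈ N} l₂)
    (hh₂ : IsGreatest {y₂ : ℝ | ∃ y₁ : ℝ, (y₁, y₂) ∈ N} h₂)
    (hh₁ : IsGreatest {y₁ : ℝ | (y₁, h₂) ∈ N} h₁)
    (f₁ f₂ : ℝ) (hf : (f₁, f₂) ∈ N) (hf₁ : 0 < f₁) (hf₂ : 0 < f₂)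
    (hmax : ∀ y ∈ N, 0 < y.1 → 0 < y.2 →
      w₁ * Real.log y.1 + w₂ * Real.log y.2 ≤
        w₁ * Real.log f₁ + w₂ * Real.log f₂) :
    h₁ ≤ f₁ ∧ f₁ ≤ l₁ ∧ l₂ ≤ f₂ ∧ f₂ ≤ h₂ := by
  have a : f₁ ≤ l₁ := hl₁.2 ⟨f₂, hf⟩
  have b : f₂ ≤ h₂ := hh₂.2 ⟨f₁, hf⟩
  refine ⟨?_, a, ?_, b⟩
  · by_contra! hc
    have h := hmax (h₁, h₂) hh₁.1 (hf₁.trans hc) (hf₂.trans_le b)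
    have e1 := mul_lt_mul_of_pos_left (Real.log_lt_log hf₁ hc) hw₁
    have e2 := mul_le_mul_of_nonneg_left (Real.log_le_log hf₂ b) hw₂.le
    simp only at h
    linarith
  · by_contra! hc
    have h := hmax (l₁, l₂) hl₂.1 (hf₁.trans_le a) (hf₂.trans hc)
    have e1 := mul_lt_mul_of_pos_left (Real.log_lt_log hf₂ hc) hw₂
    have e2 := mul_le_mul_of_nonneg_left (Real.log_le_log hf₁ a) hw₁.le
    simp only at h
    linarith
end
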